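/- arXiv:2508.21602 — 2 statements merged into one kernel-verified Lean document; each statement's English description precedes it below -/
import Mathlib

section
/- Let S ⊆ ({0,1}ⁿ)ʷ, let 0 < α < 1 with 2^{αn} ∈ ℕ, and let ε₁, ε₂, ε₃ > 0. Suppose: (i) |S| ≤ 2^{αnw}; (ii) S contains no Bottleneck-Slice, i.e. for every coordinate i and every y ∈ {0,1}ⁿ, the slice of S in coordinate i at y is either empty or has size at least 2^{αn(w−1−ε₁−ε₂)}; and (iii) for every discrete (2^{αn})-box V of dimension w, |S ∩ V| < 2^{αnw(1 − ε₁ − ε₂ − ε₃ − 1/(αn))}. Then |S| ≤ 2^{(1−ε₃)αnw}. -/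
open Finset

namespace Stmt7

/-- Bit strings of length `n`, i.e. `{0,1}ⁿ`. -/
abbrev Str (n : ℕ) := Fin n → Bool

/-- The space `({0,1}ⁿ)ʷ`. -/
abbrev Space (n w : ℕ) := Fin w → Str n

/-- A family `Us` of subsets of `{0,1}ⁿ` describes a discrete `q`-box of dimension `w`
(the box itself being the product set `Fintype.piFinset Us`). -/
def IsBox (n w q : ℕ) (Us : Fin w → Finset (Str n)) : Prop :=
  ∀ i, (Us i).card = q

/-- `|{x ∈ U : π(x) ∈ V}|` for the boxes `U = U₁ × ⋯ × U_w` and `V = V₁ × ⋯ × V_w`. -/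
def boxCount {n w : ℕ} (π : Space n w → Space n w)
    (Us Vs : Fin w → Finset (Str n)) : ℕ :=
  ((Fintype.piFinset Us).filter (fun x => π x ∈ Fintype.piFinset Vs)).card

/-- A set of size at most `k * q` in a type with at least `q` elements is covered by `k` sets
of size exactly `q`. -/
theorem exists_cover_of_card_le_mul {β : Type*} [Fintype β] [DecidableEq β] {q : ℕ}
    (hq : q ≤ Fintype.card β) (k : ℕ) (P : Finset β) (hP : P.card ≤ k * q) :
    ∃ f : Fin k → Finset β, (∀ j, (f j).card = q) ∧ ∀ x ∈ P, ∃ j, x ∈ f j := by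
  induction k generalizing P with
  | zero =>
    have hP0 : P = ∅ := by simpa using hP
    exact ⟨fun _ => ∅, fun j => j.elim0, by simp [hP0]⟩
  | succ k ih =>
    obtain ⟨A, hA, hA'⟩ : ∃ A : Finset β, A.card = q ∧ (P \ A).card ≤ k * q := by
      rcases le_total q P.card with h | h
      · obtain ⟨A, hAP, hA⟩ := Finset.exists_subset_card_eq h
        refine ⟨A, hA, ?_⟩
        rw [Finset.card_sdiff_of_subset hAP, hA]
        rw [Nat.succ_mul] at hP
        omega
      · obtain ⟨A, hPA, hA⟩ := Finset.exists_superset_card_eq h hq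
        exact ⟨A, hA, by simp [Finset.sdiff_eq_empty_iff_subset.2 hPA]⟩
    obtain ⟨f, hf, hcov⟩ := ih (P \ A) hA'
    refine ⟨Fin.cons A f, fun j => ?_, fun x hx => ?_⟩
    · refine Fin.cases ?_ (fun j => ?_) j
      · simpa using hA
      · simpa using hf j
    · by_cases hxA : x ∈ A
      · exact ⟨0, by simpa using hxA⟩
      · obtain ⟨j, hj⟩ := hcov x (Finset.mem_sdiff.2 ⟨hx, hxA⟩)
        exact ⟨j.succ, by simpa using hj⟩

/-- If every nonempty fibre of `g` over `S` has at least `t` elements, then the image of `S`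
has at most `|S| / t` elements. -/
theorem card_image_mul_le_card {β γ : Type*} [DecidableEq γ] (S : Finset β) (g : β → γ) (t : ℝ)
    (h : ∀ y, S.filter (fun v => g v = y) = ∅ ∨ t ≤ ((S.filter (fun v => g v = y)).card : ℝ)) :
    ((S.image g).card : ℝ) * t ≤ S.card := by
  rw [Finset.card_eq_sum_card_image g S, ← nsmul_eq_mul, Nat.cast_sum]
  refine Finset.card_nsmul_le_sum _ _ _ fun y hy => ?_
  obtain ⟨v, hv, rfl⟩ := Finset.mem_image.1 hy
  refine (h (g v)).resolve_left fun he => ?_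
  have hmem : v ∈ S.filter (fun u => g u = g v) := by simp [hv]
  simp [he] at hmem

/-- If every coordinate projection of `S` is covered by `k` sets of size `q`, and `S` meets each
`q`-box in at most `b` points, then `|S| ≤ k ^ w * b`. -/
theorem card_le_pow_mul_of_cover {n w q k : ℕ} (S : Finset (Space n w)) (b : ℝ)
    (f : Fin w → Fin k → Finset (Str n)) (hf : ∀ i j, (f i j).card = q)
    (hcov : ∀ v ∈ S, ∀ i, ∃ j, v i ∈ f i j)
    (hb : ∀ Vs : Fin w → Finset (Str n), IsBox n w q Vs →
      ((S ∩ Fintype.piFinset Vs).card : ℝ) ≤ b) :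
    (S.card : ℝ) ≤ (k : ℝ) ^ w * b := by
  have hsub : S ⊆ (Finset.univ : Finset (Fin w → Fin k)).biUnion
      fun g => S ∩ Fintype.piFinset fun i => f i (g i) := by
    intro v hv
    choose g hg using hcov v hv
    simp only [Finset.mem_biUnion, Finset.mem_univ, true_and, Finset.mem_inter,
      Fintype.mem_piFinset]
    exact ⟨g, hv, hg⟩
  have hle := (Finset.card_le_card hsub).trans Finset.card_biUnion_le
  calc (S.card : ℝ)
      ≤ ∑ g : Fin w → Fin k, ((S ∩ Fintype.piFinset fun i => f i (g i)).card : ℝ) := by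
        exact_mod_cast hle
    _ ≤ ∑ _g : Fin w → Fin k, b := Finset.sum_le_sum fun g _ => hb _ fun i => hf i (g i)
    _ = (k : ℝ) ^ w * b := by simp

/-- If `S ⊆ ({0,1}ⁿ)ʷ` satisfies `|S| ≤ 2^{αnw}`, contains no
Bottleneck-Slice (every slice in coordinate `i` at a point `y` is either empty or of size
at least `2^{αn(w−1−ε₁−ε₂)}`), and `|S ∩ V| < 2^{αnw(1 − ε₁ − ε₂ − ε₃ − 1/(αn))}` for
every discrete `2^{αn}`-box `V`, then `|S| ≤ 2^{(1−ε₃)αnw}`. -/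
theorem stmt7 (n w : ℕ) (α ε₁ ε₂ ε₃ : ℝ)
    (hα0 : 0 < α) (hα1 : α < 1) (hε₁ : 0 < ε₁) (hε₂ : 0 < ε₂) (hε₃ : 0 < ε₃)
    (q : ℕ) (hq : (2 : ℝ) ^ (α * n) = q)
    (S : Finset (Space n w))
    (hcard : (S.card : ℝ) ≤ (2 : ℝ) ^ (α * n * w))
    (hslice : ∀ (i : Fin w) (y : Str n),
      S.filter (fun v => v i = y) = ∅ ∨
        (2 : ℝ) ^ (α * n * ((w : ℝ) - 1 - ε₁ - ε₂))
          ≤ ((S.filter (fun v => v i = y)).card : ℝ))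
    (hbox : ∀ Vs : Fin w → Finset (Str n), IsBox n w q Vs →
      ((S ∩ Fintype.piFinset Vs).card : ℝ)
        < (2 : ℝ) ^ (α * n * w * (1 - ε₁ - ε₂ - ε₃ - 1 / (α * n)))) :
    (S.card : ℝ) ≤ (2 : ℝ) ^ ((1 - ε₃) * α * n * w) := by
  rcases Nat.eq_zero_or_pos n with rfl | hn
  · simpa using hcard
  have hn' : (0 : ℝ) < n := by exact_mod_cast hn
  have hαn : 0 < α * n := mul_pos hα0 hn'
  have hqn : q ≤ Fintype.card (Str n) := by
    have h : (q : ℝ) ≤ 2 ^ (n : ℝ) := by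
      rw [← hq]
      exact Real.rpow_le_rpow_of_exponent_le one_le_two (by nlinarith)
    rw [Real.rpow_natCast] at h
    simpa using (by exact_mod_cast h : q ≤ 2 ^ n)
  set r : ℝ := (2 : ℝ) ^ (α * n * (ε₁ + ε₂)) with hr
  have hr1 : 1 ≤ r := Real.one_le_rpow one_le_two (by positivity)
  have hk : (⌈r⌉₊ : ℝ) ≤ 2 * r := by
    linarith [Nat.ceil_lt_add_one (zero_le_one.trans hr1)]
  have hproj (i : Fin w) : (S.image fun v => v i).card ≤ ⌈r⌉₊ * q := by
    have h := (card_image_mul_le_card S (fun v => v i) _ (hslice i)).trans hcard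
    have hsplit : (2 : ℝ) ^ (α * n * w)
        = r * q * 2 ^ (α * n * ((w : ℝ) - 1 - ε₁ - ε₂)) := by
      rw [hr, ← hq, ← Real.rpow_add two_pos, ← Real.rpow_add two_pos]
      congr 1
      ring
    rw [hsplit] at h
    have h' := le_of_mul_le_mul_right h (Real.rpow_pos_of_pos two_pos _)
    have h'' := h'.trans (mul_le_mul_of_nonneg_right (Nat.le_ceil r) (Nat.cast_nonneg q))
    exact_mod_cast h''
  choose f hf hcov using fun i => exists_cover_of_card_le_mul hqn ⌈r⌉₊ _ (hproj i)
  calc (S.card : ℝ)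
      ≤ (⌈r⌉₊ : ℝ) ^ w * 2 ^ (α * n * w * (1 - ε₁ - ε₂ - ε₃ - 1 / (α * n))) :=
        card_le_pow_mul_of_cover S _ f hf
          (fun v hv i => hcov i _ (Finset.mem_image_of_mem _ hv)) fun Vs hVs => (hbox Vs hVs).le
    _ ≤ (2 * r) ^ w * 2 ^ (α * n * w * (1 - ε₁ - ε₂ - ε₃ - 1 / (α * n))) := by gcongr
    _ = 2 ^ ((1 - ε₃) * α * n * w) := by
        have h2r : 2 * r = 2 ^ (1 + α * n * (ε₁ + ε₂)) := by
          rw [Real.rpow_add two_pos, Real.rpow_one]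
        rw [h2r, ← Real.rpow_natCast, ← Real.rpow_mul two_pos.le, ← Real.rpow_add two_pos]
        congr 1
        field_simp
        ring

end Stmt7
end

section
/- Let X be a random variable on a finite set Ω and let k ∈ ℕ with 2^k ≤ |Ω|. If the min-entropy of X is at least k (that is, P[X = x] ≤ 2^{−k} for every x ∈ Ω), then the distribution of X is a convex combination of flat distributions supported on sets of size exactly 2^k, i.e. of uniform distributions on subsets S ⊆ Ω with |S| = 2^k. -/
open Finset

namespace Stmt10

/-- The coordinates of `q` that lie strictly between `0` and `1`. -/
noncomputable def fractionalCoords {Ω : Type*} [Fintype Ω] (q : Ω → ℝ) : Finset Ω :=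
  {x | 0 < q x ∧ q x < 1}

/-- The `0/1` vector of a finite set. -/
def indicatorVec {Ω : Type*} [DecidableEq Ω] (S : Finset Ω) : Ω → ℝ :=
  fun x => if x ∈ S then 1 else 0

/-- Shifting mass from one fractional coordinate to another until one of them becomes integral. -/
lemma exists_shift {Ω : Type*} [Fintype Ω] [DecidableEq Ω] {q : Ω → ℝ} (h0 : ∀ x, 0 ≤ q x)
    (h1 : ∀ x, q x ≤ 1) {i j : Ω} (hij : i ≠ j) (hi : i ∈ fractionalCoords q)
    (hj : j ∈ fractionalCoords q) :
    ∃ (a : ℝ) (r : Ω → ℝ), 0 < a ∧ r = q + a • (Pi.single i 1 - Pi.single j 1) ∧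
      (∀ x, 0 ≤ r x) ∧ (∀ x, r x ≤ 1) ∧ ∑ x, r x = ∑ x, q x ∧
      #(fractionalCoords r) < #(fractionalCoords q) := by
  simp only [fractionalCoords, mem_filter, mem_univ, true_and] at hi hj
  obtain ⟨a, ha, hai, haj, hor⟩ :
      ∃ a : ℝ, 0 < a ∧ a ≤ 1 - q i ∧ a ≤ q j ∧ (a = 1 - q i ∨ a = q j) :=
    ⟨min (1 - q i) (q j), lt_min (by linarith) hj.1, min_le_left _ _, min_le_right _ _,
      min_choice _ _⟩
  set r := q + a • (Pi.single i 1 - Pi.single j 1 : Ω → ℝ) with hr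
  have ri : r i = q i + a := by simp [hr, hij]
  have rj : r j = q j - a := by simp [hr, hij.symm, sub_eq_add_neg]
  have rx : ∀ x, x ≠ i → x ≠ j → r x = q x := fun x hxi hxj => by simp [hr, hxi, hxj]
  refine ⟨a, r, ha, hr, fun x => ?_, fun x => ?_, ?_, card_lt_card ?_⟩
  · by_cases hxi : x = i
    · subst hxi; linarith
    by_cases hxj : x = j
    · subst hxj; linarith
    rw [rx x hxi hxj]; exact h0 x
  · by_cases hxi : x = i
    · subst hxi; linarith
    by_cases hxj : x = j
    · subst hxj; linarith
    rw [rx x hxi hxj]; exact h1 x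
  · simp [hr, sum_add_distrib, ← mul_sum]
  · have hsub : fractionalCoords r ⊆ fractionalCoords q := fun x hx => by
      simp only [fractionalCoords, mem_filter, mem_univ, true_and] at hx ⊢
      by_cases hxi : x = i
      · subst hxi; exact hi
      by_cases hxj : x = j
      · subst hxj; exact hj
      rwa [rx x hxi hxj] at hx
    rw [ssubset_iff_of_subset hsub]
    rcases hor with h | h
    · refine ⟨i, by simpa [fractionalCoords] using hi, ?_⟩
      simp [fractionalCoords, ri, h]
    · refine ⟨j, by simpa [fractionalCoords] using hj, ?_⟩
      simp [fractionalCoords, rj, h]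

/-- A vector of the cube that has an integral coordinate sum does not have exactly one
fractional coordinate. -/
lemma exists_ne_mem_fractionalCoords {Ω : Type*} [Fintype Ω] [DecidableEq Ω] {q : Ω → ℝ}
    (h0 : ∀ x, 0 ≤ q x) (h1 : ∀ x, q x ≤ 1) {n : ℕ} (hsum : ∑ x, q x = n) {i : Ω}
    (hi : i ∈ fractionalCoords q) : ∃ j ∈ fractionalCoords q, i ≠ j := by
  by_contra! h
  have hval : ∀ x ∈ univ.erase i, q x = if q x = 1 then 1 else 0 := fun x hx => by
    split_ifs with hx1
    · exact hx1
    by_contra hx0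
    refine (mem_erase.1 hx).1 (h x ?_).symm
    simpa [fractionalCoords] using ⟨(h0 x).lt_of_ne' hx0, (h1 x).lt_of_ne hx1⟩
  rw [← add_sum_erase _ _ (mem_univ i), sum_congr rfl hval, sum_boole] at hsum
  simp only [fractionalCoords, mem_filter, mem_univ, true_and] at hi
  have hlt : #{x ∈ univ.erase i | q x = 1} < n := by
    exact_mod_cast (by linarith : ((#{x ∈ univ.erase i | q x = 1} : ℕ) : ℝ) < n)
  have hle : ((#{x ∈ univ.erase i | q x = 1} : ℕ) : ℝ) + 1 ≤ n := by exact_mod_cast hlt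
  linarith

/-- The hypersimplex is the convex hull of the `0/1` vectors it contains. -/
lemma mem_convexHull_indicatorVec {Ω : Type*} [Fintype Ω] [DecidableEq Ω] {q : Ω → ℝ}
    (h0 : ∀ x, 0 ≤ q x) (h1 : ∀ x, q x ≤ 1) {n : ℕ} (hsum : ∑ x, q x = n) :
    q ∈ convexHull ℝ (indicatorVec '' {S : Finset Ω | #S = n}) := by
  induction hc : #(fractionalCoords q) using Nat.strong_induction_on generalizing q with
  | _ c ih =>
  subst hc
  rcases (fractionalCoords q).eq_empty_or_nonempty with he | ⟨i, hi⟩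
  · have hval : ∀ x, q x = if q x = 1 then 1 else 0 := fun x => by
      split_ifs with hx1
      · exact hx1
      by_contra hx0
      refine notMem_empty x (he ▸ ?_)
      simpa [fractionalCoords] using ⟨(h0 x).lt_of_ne' hx0, (h1 x).lt_of_ne hx1⟩
    refine subset_convexHull ℝ _ ⟨({x | q x = 1} : Finset Ω), ?_, ?_⟩
    · rw [sum_congr rfl fun x _ => hval x, sum_boole] at hsum
      exact_mod_cast hsum
    · ext x
      simpa [indicatorVec] using (hval x).symm
  · obtain ⟨j, hj, hij⟩ := exists_ne_mem_fractionalCoords h0 h1 hsum hi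
    obtain ⟨a, r, ha, rfl, ha0, ha1, has, hac⟩ := exists_shift h0 h1 hij hi hj
    obtain ⟨b, s, hb, rfl, hb0, hb1, hbs, hbc⟩ := exists_shift h0 h1 hij.symm hj hi
    have hA := ih _ hac ha0 ha1 (has.trans hsum) rfl
    have hB := ih _ hbc hb0 hb1 (hbs.trans hsum) rfl
    have hab : a + b ≠ 0 := by positivity
    convert convex_convexHull ℝ _ hA hB (a := b / (a + b)) (b := a / (a + b)) (by positivity)
      (by positivity) (by field_simp; ring) using 1
    ext x
    simp only [Pi.add_apply, Pi.smul_apply, Pi.sub_apply, smul_eq_mul]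
    field_simp
    ring

/-- If a distribution `p` on a finite set `Ω` with `2^k ≤ |Ω|` has
min-entropy at least `k` (i.e. `p x ≤ 2^{−k}` for all `x`), then `p` is a convex
combination of flat (uniform) distributions supported on subsets of `Ω` of size exactly
`2^k`. -/
theorem stmt10 {Ω : Type*} [Fintype Ω] [DecidableEq Ω] (p : Ω → ℝ) (k : ℕ)
    (hnonneg : ∀ x, 0 ≤ p x) (hsum : ∑ x, p x = 1)
    (hΩ : 2 ^ k ≤ Fintype.card Ω)
    (hminent : ∀ x, p x ≤ ((2 : ℝ) ^ k)⁻¹) :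
    ∃ μ : Finset Ω → ℝ,
      (∀ S, 0 ≤ μ S) ∧
      (∀ S, μ S ≠ 0 → S.card = 2 ^ k) ∧
      (∑ S : Finset Ω, μ S) = 1 ∧
      ∀ x, p x = ∑ S : Finset Ω, μ S * (if x ∈ S then ((S.card : ℝ))⁻¹ else 0) := by
  have hk : (0 : ℝ) < 2 ^ k := by positivity
  have hq : (fun x => 2 ^ k * p x) ∈
      convexHull ℝ (indicatorVec '' {S : Finset Ω | #S = 2 ^ k}) := by
    refine mem_convexHull_indicatorVec (fun x => mul_nonneg hk.le (hnonneg x)) (fun x => ?_) ?_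
    · calc 2 ^ k * p x ≤ 2 ^ k * ((2 : ℝ) ^ k)⁻¹ := by gcongr; exact hminent x
        _ = 1 := mul_inv_cancel₀ hk.ne'
    · rw [← mul_sum, hsum]; simp
  obtain ⟨ι, _, w, z, hw0, hw1, hz, hwz⟩ := mem_convexHull_iff_exists_fintype.1 hq
  choose T hT hTz using hz
  have hsumμ (f : Finset Ω → ℝ) :
      ∑ S, (∑ i with T i = S, w i) * f S = ∑ i, w i * f (T i) := by
    rw [← sum_fiberwise univ T fun i => w i * f (T i)]
    refine sum_congr rfl fun S _ => ?_
    rw [sum_mul]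
    exact sum_congr rfl fun i hi => by rw [(mem_filter.1 hi).2]
  refine ⟨fun S => ∑ i with T i = S, w i, fun S => sum_nonneg fun i _ => hw0 i,
    fun S hS => ?_, ?_, fun x => ?_⟩
  · obtain ⟨i, hi, -⟩ := exists_ne_zero_of_sum_ne_zero hS
    exact (mem_filter.1 hi).2 ▸ hT i
  · rw [sum_fiberwise, hw1]
  · have hx := congrFun hwz x
    simp only [Finset.sum_apply, Pi.smul_apply, ← hTz, indicatorVec, smul_eq_mul] at hx
    rw [hsumμ fun S => if x ∈ S then (#S : ℝ)⁻¹ else 0, ← mul_right_inj' hk.ne', ← hx, mul_sum]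
    refine sum_congr rfl fun i _ => ?_
    have hTi : #(T i) = 2 ^ k := hT i
    rw [hTi]
    split_ifs
    · push_cast; field_simp
    · simp

end Stmt10
end
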